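/- arXiv:1902.06041 — 3 statements merged into one kernel-verified Lean document; each statement's English description precedes it below -/
import Mathlib

section
/- If LICQ holds on S, then the image f(Σ(f,S)) of the set of critical points of f on S under f is a finite subset of ℝ. -/
open Filter

noncomputable section

def IsPolyFun {n : ℕ} (f : EuclideanSpace ℝ (Fin n) → ℝ) : Prop :=
  ∃ P : MvPolynomial (Fin n) ℝ, ∀ x, f x = MvPolynomial.eval (fun i => x i) P

def conSet {n l m : ℕ} (g : Fin l → EuclideanSpace ℝ (Fin n) → ℝ)
    (h : Fin m → EuclideanSpace ℝ (Fin n) → ℝ) : Set (EuclideanSpace ℝ (Fin n)) :=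
  {x | (∀ i, g i x = 0) ∧ (∀ j, 0 ≤ h j x)}

def LICQ {n l m : ℕ} (g : Fin l → EuclideanSpace ℝ (Fin n) → ℝ)
    (h : Fin m → EuclideanSpace ℝ (Fin n) → ℝ) : Prop :=
  ∀ x ∈ conSet g h, LinearIndependent ℝ
    (Sum.elim (fun i : Fin l => gradient (g i) x)
      (fun j : {j : Fin m // h j x = 0} => gradient (h j.1) x))

def criticalSet {n l m : ℕ} (f : EuclideanSpace ℝ (Fin n) → ℝ)
    (g : Fin l → EuclideanSpace ℝ (Fin n) → ℝ)
    (h : Fin m → EuclideanSpace ℝ (Fin n) → ℝ) : Set (EuclideanSpace ℝ (Fin n)) :=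
  {x | x ∈ conSet g h ∧ ∃ (lam : Fin l → ℝ) (nu : Fin m → ℝ),
    gradient f x - ∑ i, lam i • gradient (g i) x - ∑ j, nu j • gradient (h j) x = 0 ∧
    ∀ j, nu j * h j x = 0}

def tangencySet {n l m : ℕ} (f : EuclideanSpace ℝ (Fin n) → ℝ)
    (g : Fin l → EuclideanSpace ℝ (Fin n) → ℝ)
    (h : Fin m → EuclideanSpace ℝ (Fin n) → ℝ) : Set (EuclideanSpace ℝ (Fin n)) :=
  {x | x ∈ conSet g h ∧ ∃ (κ : ℝ) (lam : Fin l → ℝ) (nu : Fin m → ℝ) (μ : ℝ),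
    (κ, lam, nu, μ) ≠ 0 ∧
    κ • gradient f x - ∑ i, lam i • gradient (g i) x - ∑ j, nu j • gradient (h j) x - μ • x = 0 ∧
    ∀ j, nu j * h j x = 0}

def tangencyValues {n l m : ℕ} (f : EuclideanSpace ℝ (Fin n) → ℝ)
    (g : Fin l → EuclideanSpace ℝ (Fin n) → ℝ)
    (h : Fin m → EuclideanSpace ℝ (Fin n) → ℝ) : Set ℝ :=
  {lam | ∃ x : ℕ → EuclideanSpace ℝ (Fin n), (∀ k, x k ∈ tangencySet f g h) ∧
    Tendsto (fun k => ‖x k‖) atTop atTop ∧ Tendsto (fun k => f (x k)) atTop (nhds lam)}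

def psi {n l m : ℕ} (f : EuclideanSpace ℝ (Fin n) → ℝ)
    (g : Fin l → EuclideanSpace ℝ (Fin n) → ℝ)
    (h : Fin m → EuclideanSpace ℝ (Fin n) → ℝ) (t : ℝ) : EReal :=
  sInf ((fun x => (f x : EReal)) '' {x | x ∈ conSet g h ∧ ‖x‖ = t})

def CoerciveOn {n : ℕ} (f : EuclideanSpace ℝ (Fin n) → ℝ)
    (S : Set (EuclideanSpace ℝ (Fin n))) : Prop :=
  ∀ x : ℕ → EuclideanSpace ℝ (Fin n), (∀ k, x k ∈ S) →
    Tendsto (fun k => ‖x k‖) atTop atTop → Tendsto (fun k => f (x k)) atTop atTop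

/-- A derivation out of a field of characteristic zero that vanishes on a set over whose generated
subfield the field is algebraic vanishes identically. -/
theorem derivation_eq_zero_of_isAlgebraic_adjoin {k K M : Type*} [Field k] [CharZero k] [Field K]
    [Algebra k K] [AddCommGroup M] [Module K M] [Module k M] [IsScalarTower k K M]
    (D : Derivation k K M) (s : Set K) (hs : ∀ x ∈ s, D x = 0)
    [Algebra.IsAlgebraic (IntermediateField.adjoin k s) K] : D = 0 := by
  let E := IntermediateField.adjoin k s
  have hE : ∀ x ∈ E, D x = 0 := fun x hx => by
    induction hx using IntermediateField.adjoin_induction with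
    | mem x hx => exact hs x hx
    | algebraMap x => exact D.map_algebraMap x
    | add x y _ _ hx hy => rw [map_add, hx, hy, add_zero]
    | inv x _ hx => rw [Derivation.leibniz_inv, hx, smul_zero]
    | mul x y _ _ hx hy => rw [Derivation.leibniz, hx, hy, smul_zero, smul_zero, add_zero]
  let D' : Derivation E K M := Derivation.mk'
    { toFun := D
      map_add' := map_add D
      map_smul' := fun a x => by
        rw [Algebra.smul_def, Derivation.leibniz]
        simp [hE a a.2, IntermediateField.algebraMap_apply, IntermediateField.smul_def] }
    (fun a b => D.leibniz a b)
  have : CharZero E := charZero_of_injective_algebraMap (algebraMap k E).injective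
  have : Algebra.FormallyUnramified E K := Algebra.FormallyUnramified.of_isSeparable E K
  ext x
  have h : D'.liftKaehlerDifferential (KaehlerDifferential.D E K x) = D' x :=
    D'.liftKaehlerDifferential_comp_D x
  rw [Subsingleton.elim (KaehlerDifferential.D E K x) 0, map_zero] at h
  exact h.symm

/-- Over a field of characteristic zero, an element of a finitely generated field extension whose
universal differential is zero is algebraic. -/
theorem isAlgebraic_of_kaehlerDifferential_D_eq_zero {k K : Type*} [Field k] [CharZero k] [Field K]
    [Algebra k K] [Algebra.EssFiniteType k K] (t : K) (ht : KaehlerDifferential.D k K t = 0) :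
    IsAlgebraic k t := by
  by_contra htr
  have hind : AlgebraicIndepOn k id {t} := by
    rw [AlgebraicIndepOn, algebraicIndependent_singleton_iff ⟨t, rfl⟩]
    exact htr
  obtain ⟨s, hts, hs⟩ := exists_isTranscendenceBasis_superset hind
  have hts : t ∈ s := hts rfl
  let F := IntermediateField.adjoin k (s \ {t})
  have hF : Transcendental F t := by
    have h := hs.1.transcendental_adjoin (s := {⟨t, hts⟩}ᶜ) (i := ⟨t, hts⟩) (by simp)
    have himg : ((↑) : s → K) '' {⟨t, hts⟩}ᶜ = s \ {t} := by
      ext x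
      simp only [Set.mem_image, Set.mem_compl_iff, Set.mem_singleton_iff, Subtype.exists,
        Set.mem_sdiff]
      grind
    rw [himg] at h
    exact fun h' => h (IntermediateField.isAlgebraic_adjoin_iff.mp h')
  have hFt : KaehlerDifferential.D F K t = 0 := by
    have h := KaehlerDifferential.map_D k F K K t
    rw [ht, map_zero] at h
    exact h.symm
  have hD : (KaehlerDifferential.D F K).restrictScalars k = 0 := by
    have := hs.isAlgebraic_field
    rw [Subtype.range_coe] at this
    refine derivation_eq_zero_of_isAlgebraic_adjoin _ s fun x hx => ?_
    by_cases hxt : x = t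
    · rw [hxt]; exact hFt
    · exact (KaehlerDifferential.D F K).map_algebraMap
        (⟨x, IntermediateField.subset_adjoin k _ ⟨hx, hxt⟩⟩ : F)
  have : Subsingleton (Ω[K⁄F]) := by
    rw [← Submodule.subsingleton_iff K, ← subsingleton_iff_bot_eq_top,
      ← KaehlerDifferential.span_range_derivation, eq_comm, Submodule.span_eq_bot]
    rintro _ ⟨x, rfl⟩
    exact DFunLike.congr_fun hD x
  have : Algebra.FormallyUnramified F K := ⟨this⟩
  have : Algebra.EssFiniteType F K := .of_comp k F K
  have := Algebra.FormallyUnramified.isSeparable F K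
  exact hF (Algebra.IsAlgebraic.isAlgebraic t)

theorem MvPolynomial.derivation_eq_sum_pderiv_smul {σ R M : Type*} [Fintype σ] [CommRing R]
    [AddCommGroup M] [Module R M] [Module (MvPolynomial σ R) M]
    [IsScalarTower R (MvPolynomial σ R) M]
    (D : Derivation R (MvPolynomial σ R) M) (P : MvPolynomial σ R) :
    D P = ∑ i, pderiv i P • D (X i) := by
  classical
  have hsum : ∀ Q, (∑ i, (LinearMap.toSpanSingleton (MvPolynomial σ R) M (D (X i))).compDer
      (pderiv i) : Derivation R (MvPolynomial σ R) M) Q = ∑ i, pderiv i Q • D (X i) := fun Q => by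
    rw [← Derivation.coeFnAddMonoidHom_apply, map_sum, Finset.sum_apply]
    rfl
  rw [← hsum]
  congr 1
  refine derivation_ext fun j => ?_
  rw [hsum]
  simp [pderiv_X, Pi.single_apply, ite_smul]

/-- A polynomial is algebraic over the base field modulo any prime ideal containing its partial
derivatives. -/
theorem MvPolynomial.exists_aeval_mem_of_pderiv_mem {σ k : Type*} [Fintype σ] [Field k]
    [CharZero k] (P : MvPolynomial σ k) (p : Ideal (MvPolynomial σ k)) [p.IsPrime]
    (hp : ∀ i, pderiv i P ∈ p) :
    ∃ q : Polynomial k, q ≠ 0 ∧ Polynomial.aeval P q ∈ p := by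
  let K := p.ResidueField
  have : Algebra.EssFiniteType k K := .comp k (MvPolynomial σ k) K
  have ht : KaehlerDifferential.D k K (algebraMap _ K P) = 0 := by
    have h := derivation_eq_sum_pderiv_smul
      ((KaehlerDifferential.D k K).compAlgebraMap (MvPolynomial σ k)) P
    refine Eq.trans h (Finset.sum_eq_zero fun i _ => ?_)
    rw [← algebraMap_smul K (pderiv i P), Ideal.algebraMap_residueField_eq_zero.mpr (hp i),
      zero_smul]
  obtain ⟨q, hq, hq'⟩ := isAlgebraic_of_kaehlerDifferential_D_eq_zero _ ht
  refine ⟨q, hq, ?_⟩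
  rwa [Polynomial.aeval_algebraMap_apply, Ideal.algebraMap_residueField_eq_zero] at hq'

/-- A polynomial over a field of characteristic zero has finitely many critical values. -/
theorem MvPolynomial.finite_critical_values {σ k : Type*} [Fintype σ] [Field k] [CharZero k]
    (P : MvPolynomial σ k) :
    ((fun z => eval z P) '' {z : σ → k | ∀ i, eval z (pderiv i P) = 0}).Finite := by
  let I : Ideal (MvPolynomial σ k) := Ideal.span (Set.range fun i => pderiv i P)
  have hq : ∀ p : I.minimalPrimes, ∃ q : Polynomial k, q ≠ 0 ∧ Polynomial.aeval P q ∈ p.1 := by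
    rintro ⟨p, hp⟩
    have : p.IsPrime := hp.1.1
    exact exists_aeval_mem_of_pderiv_mem P p fun i => hp.1.2 (Ideal.subset_span ⟨i, rfl⟩)
  choose q hq0 hq using hq
  have : Finite I.minimalPrimes := I.finite_minimalPrimes_of_isNoetherianRing
  refine (Set.finite_iUnion fun p => (q p).rootSet_finite k).subset ?_
  rintro _ ⟨z, hz, rfl⟩
  have hI : I ≤ RingHom.ker (eval z) := by
    rw [Ideal.span_le]
    rintro _ ⟨i, rfl⟩
    exact hz i
  have : (RingHom.ker (eval z)).IsPrime := RingHom.ker_isPrime _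
  obtain ⟨p, hp, hpz⟩ := Ideal.exists_minimalPrimes_le hI
  refine Set.mem_iUnion.mpr ⟨⟨p, hp⟩, ?_⟩
  rw [Polynomial.mem_rootSet]
  refine ⟨hq0 _, ?_⟩
  have h : aeval z (Polynomial.aeval P (q ⟨p, hp⟩)) = 0 := hpz (hq ⟨p, hp⟩)
  rwa [← Polynomial.aeval_algHom_apply] at h

theorem MvPolynomial.hasFDerivAt_eval {n : ℕ} (P : MvPolynomial (Fin n) ℝ)
    (x : EuclideanSpace ℝ (Fin n)) :
    HasFDerivAt (fun y : EuclideanSpace ℝ (Fin n) => eval (fun i => y i) P)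
      (∑ i, eval (fun i => x i) (pderiv i P) • EuclideanSpace.proj (𝕜 := ℝ) i) x := by
  classical
  induction P using MvPolynomial.induction_on with
  | C a => simpa using hasFDerivAt_const a x
  | add p q hp hq => 
    simp only [map_add, add_smul, Finset.sum_add_distrib]
    exact hp.add hq
  | mul_X p j hp =>
    have hj : HasFDerivAt (fun y : EuclideanSpace ℝ (Fin n) => y j)
        (EuclideanSpace.proj (𝕜 := ℝ) j) x :=
      (EuclideanSpace.proj (𝕜 := ℝ) j : EuclideanSpace ℝ (Fin n) →L[ℝ] ℝ).hasFDerivAt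
    have h := hp.mul hj
    simp only [map_mul, eval_X]
    refine h.congr_fderiv ?_
    simp only [pderiv_mul, pderiv_X, map_add, map_mul, eval_X, add_smul, Finset.sum_add_distrib,
      Finset.smul_sum, Pi.single_apply]
    rw [add_comm]
    congr 1
    · exact Finset.sum_congr rfl fun i _ => by rw [smul_smul, mul_comm]
    · rw [Finset.sum_eq_single j]
      · simp
      · intro i _ hi
        simp [hi.symm]
      · simp

theorem gradient_apply_eq_eval_pderiv {n : ℕ} {f : EuclideanSpace ℝ (Fin n) → ℝ}
    {P : MvPolynomial (Fin n) ℝ} (hP : ∀ x, f x = MvPolynomial.eval (fun i => x i) P)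
    (x : EuclideanSpace ℝ (Fin n)) (i : Fin n) :
    gradient f x i = MvPolynomial.eval (fun i => x i) (MvPolynomial.pderiv i P) := by
  obtain rfl : f = fun x => MvPolynomial.eval (fun i => x i) P := funext hP
  have h := DFunLike.congr_fun ((toDual_gradient (𝕜 := ℝ)).trans (P.hasFDerivAt_eval x).fderiv)
    (EuclideanSpace.single i (1 : ℝ))
  rw [InnerProductSpace.toDual_apply_apply, EuclideanSpace.inner_single_right] at h
  simpa using h

open MvPolynomial in
theorem critical_values_finite {n l m : ℕ} (f : EuclideanSpace ℝ (Fin n) → ℝ)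
    (g : Fin l → EuclideanSpace ℝ (Fin n) → ℝ) (h : Fin m → EuclideanSpace ℝ (Fin n) → ℝ)
    (hf : IsPolyFun f) (hg : ∀ i, IsPolyFun (g i)) (hh : ∀ j, IsPolyFun (h j))
    (hS : (conSet g h).Nonempty) (hSu : ¬ Bornology.IsBounded (conSet g h))
    (hlicq : LICQ g h) :
    (f '' criticalSet f g h).Finite := by
  classical
  obtain ⟨F, hF⟩ := hf
  choose G hG using hg
  choose H hH using hh
  let lagrangian : MvPolynomial (Fin n ⊕ Fin l ⊕ Fin m) ℝ :=
    rename Sum.inl F - ∑ i, X (Sum.inr (Sum.inl i)) * rename Sum.inl (G i)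
      - ∑ j, X (Sum.inr (Sum.inr j)) ^ 3 * rename Sum.inl (H j)
  refine lagrangian.finite_critical_values.subset ?_
  rintro _ ⟨x, ⟨⟨hgx, -⟩, lam, nu, hgrad, hcomp⟩, rfl⟩
  have hroot : ∀ j, ∃ w : ℝ, w ^ 3 = nu j := fun j => by
    rcases le_total 0 (nu j) with hj | hj
    · exact ⟨nu j ^ ((3 : ℕ)⁻¹ : ℝ), Real.rpow_inv_natCast_pow hj three_ne_zero⟩
    · refine ⟨-(-nu j) ^ ((3 : ℕ)⁻¹ : ℝ), ?_⟩
      rw [Odd.neg_pow (by decide), Real.rpow_inv_natCast_pow (neg_nonneg.mpr hj) three_ne_zero,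
        neg_neg]
  choose w hw using hroot
  have hw0 : ∀ j, w j = 0 ∨ h j x = 0 := fun j => by
    simpa [← hw] using hcomp j
  let z : Fin n ⊕ Fin l ⊕ Fin m → ℝ := Sum.elim (fun i => x i) (Sum.elim lam w)
  have hz : ∀ P : MvPolynomial (Fin n) ℝ, eval z (rename Sum.inl P) = eval (fun i => x i) P :=
    fun P => by rw [eval_rename]; rfl
  have hpderiv_inr : ∀ (s : Fin l ⊕ Fin m) (P : MvPolynomial (Fin n) ℝ),
      pderiv (Sum.inr s : Fin n ⊕ Fin l ⊕ Fin m) (rename Sum.inl P) = 0 := fun s P => by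
    refine pderiv_eq_zero_of_notMem_vars fun hs => ?_
    obtain ⟨i, -, hi⟩ := Finset.mem_image.mp (vars_rename _ _ hs)
    exact Sum.inl_ne_inr hi
  refine ⟨z, ?_, ?_⟩
  · rintro (i | i | j)
    · have hi := congrArg (fun v : EuclideanSpace ℝ (Fin n) => v i) hgrad
      simp only [PiLp.sub_apply, WithLp.ofLp_sum, Finset.sum_apply, PiLp.smul_apply,
        gradient_apply_eq_eval_pderiv hF, gradient_apply_eq_eval_pderiv (hG _),
        gradient_apply_eq_eval_pderiv (hH _)] at hi
      simpa [lagrangian, pderiv_mul, pderiv_pow, pderiv_rename Sum.inl_injective, hz, z, hw,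
        pderiv_X] using hi
    · simp [lagrangian, hpderiv_inr, hz, pderiv_X, Pi.single_apply, ← hG, hgx]
    · simp [lagrangian, hpderiv_inr, hz, pderiv_X, Pi.single_apply, ← hH, z, (hw0 j).symm]
  · have hsum : ∀ j, w j ^ 3 * h j x = 0 := fun j => by rw [hw, hcomp]
    simp [lagrangian, hz, ← hF, ← hG, ← hH, hgx, z, hsum]
end
end

section
/- For every t > 0 such that S ∩ {x ∈ ℝ^n : ‖x‖ = t} is nonempty, the minimum of f over the compact set S ∩ {‖x‖ = t} is attained at some point of the tangency variety Γ(f,S); consequently min{f(x) : x ∈ S, ‖x‖ = t} = min{f(x) : x ∈ Γ(f,S), ‖x‖ = t}. -/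
open Filter

noncomputable section

theorem IsPolyFun.contDiff {n : ℕ} {f : EuclideanSpace ℝ (Fin n) → ℝ} (hf : IsPolyFun f) :
    ContDiff ℝ 1 f := by
  obtain ⟨P, hP⟩ := hf
  obtain rfl : f = fun x => MvPolynomial.eval (fun i => x i) P := funext hP
  clear hP
  induction P using MvPolynomial.induction_on with
  | C a => simpa using contDiff_const
  | add p q hp hq => simpa using hp.add hq
  | mul_X p i hp =>
    have hi : ContDiff ℝ 1 fun x : EuclideanSpace ℝ (Fin n) => x i := by fun_prop
    simpa using hp.mul hi

/-- The Fritz John necessary condition on a sphere, without sign constraints on the multipliers. -/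
theorem mem_tangencySet_of_forall_le {n l m : ℕ} {f : EuclideanSpace ℝ (Fin n) → ℝ}
    {g : Fin l → EuclideanSpace ℝ (Fin n) → ℝ} {h : Fin m → EuclideanSpace ℝ (Fin n) → ℝ}
    (hf : ContDiff ℝ 1 f) (hg : ∀ i, ContDiff ℝ 1 (g i)) (hh : ∀ j, ContDiff ℝ 1 (h j))
    {x : EuclideanSpace ℝ (Fin n)} (hx : x ∈ conSet g h)
    (hmin : ∀ y ∈ conSet g h, ‖y‖ = ‖x‖ → f x ≤ f y) : x ∈ tangencySet f g h := by
  classical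
  have hstrict {u : EuclideanSpace ℝ (Fin n) → ℝ} (hu : ContDiff ℝ 1 u) :
      HasStrictFDerivAt u (fderiv ℝ u x) x := hu.contDiffAt.hasStrictFDerivAt one_ne_zero
  let c : Fin l ⊕ {j : Fin m // h j x = 0} ⊕ Unit → EuclideanSpace ℝ (Fin n) → ℝ :=
    Sum.elim g (Sum.elim (fun j => h j.1) fun _ y => ‖y‖ ^ 2)
  let c' : Fin l ⊕ {j : Fin m // h j x = 0} ⊕ Unit → StrongDual ℝ (EuclideanSpace ℝ (Fin n)) :=
    Sum.elim (fun i => fderiv ℝ (g i) x)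
      (Sum.elim (fun j => fderiv ℝ (h j.1) x) fun _ => 2 • innerSL ℝ x)
  have hc : ∀ k, HasStrictFDerivAt (c k) (c' k) x := by
    rintro (i | j | _)
    · exact hstrict (hg i)
    · exact hstrict (hh j)
    · exact hasStrictFDerivAt_norm_sq x
  have hextr : IsLocalExtrOn f {y | ∀ k, c k y = c k x} x := by
    left
    have hinactive : ∀ᶠ y in nhds x, ∀ j, h j x ≠ 0 → 0 < h j y := by
      refine eventually_all.2 fun j => ?_
      by_cases hj : h j x = 0
      · simp [hj]
      · filter_upwards [(hh j).continuous.continuousAt.eventually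
          (lt_mem_nhds ((hx.2 j).lt_of_ne' hj))] with y hy _ using hy
    filter_upwards [self_mem_nhdsWithin, mem_nhdsWithin_of_mem_nhds hinactive] with y hy hpos
    refine hmin y ⟨fun i => (hy (.inl i)).trans (hx.1 i), fun j => ?_⟩ ?_
    · by_cases hj : h j x = 0
      · exact ((hy (.inr (.inl ⟨j, hj⟩))).trans hj).ge
      · exact (hpos j hj).le
    · exact (sq_eq_sq₀ (norm_nonneg y) (norm_nonneg x)).1 (hy (.inr (.inr ())))
  obtain ⟨Λ, κ, hne, hsum⟩ := hextr.exists_multipliers_of_hasStrictFDerivAt hc (hstrict hf)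
  let nu : Fin m → ℝ := fun j => if hj : h j x = 0 then -Λ (.inr (.inl ⟨j, hj⟩)) else 0
  have hnu (j : {j : Fin m // h j x = 0}) : nu j = -Λ (.inr (.inl j)) := dif_pos j.2
  refine ⟨hx, κ, fun i => -Λ (.inl i), nu, -(2 * Λ (.inr (.inr ()))), fun h0 => hne ?_, ?_, ?_⟩
  · simp only [Prod.mk_eq_zero, funext_iff, Pi.zero_apply, neg_eq_zero, mul_eq_zero,
      OfNat.ofNat_ne_zero, false_or] at h0
    obtain ⟨h1, h2, h3, h4⟩ := h0
    refine Prod.ext (funext ?_) h1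
    rintro (i | j | _)
    · exact h2 i
    · simpa [h3 j] using (hnu j).symm
    · exact h4
  · have hnusum : ∑ j : {j : Fin m // h j x = 0}, Λ (.inr (.inl j)) • gradient (h j) x
        = -∑ j, nu j • gradient (h j) x := by
      rw [← Finset.sum_neg_distrib]
      refine Fintype.sum_of_injective Subtype.val Subtype.val_injective _ _ (fun j hj => ?_)
        fun j => by simp [hnu]
      have hj' : h j x ≠ 0 := by simpa using hj
      simp [nu, hj']
    have hx' : (InnerProductSpace.toDual ℝ _).symm (innerSL ℝ x) = x :=
      (InnerProductSpace.toDual ℝ _).symm_apply_apply x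
    have hgrad := congrArg (InnerProductSpace.toDual ℝ (EuclideanSpace ℝ (Fin n))).symm hsum
    simp only [c', Fintype.sum_sum_type, Sum.elim_inl, Sum.elim_inr, map_add, map_sum,
      map_smul, map_nsmul, map_zero, hx', Finset.univ_unique, Finset.sum_singleton] at hgrad
    simp only [← gradient.eq_1] at hgrad
    rw [hnusum] at hgrad
    rw [← hgrad]
    simp only [neg_smul, Finset.sum_neg_distrib]
    module
  · intro j
    by_cases hj : h j x = 0 <;> simp [nu, hj]

theorem min_on_sphere_attained_on_tangency {n l m : ℕ} (f : EuclideanSpace ℝ (Fin n) → ℝ)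
    (g : Fin l → EuclideanSpace ℝ (Fin n) → ℝ) (h : Fin m → EuclideanSpace ℝ (Fin n) → ℝ)
    (hf : IsPolyFun f) (hg : ∀ i, IsPolyFun (g i)) (hh : ∀ j, IsPolyFun (h j))
    (hS : (conSet g h).Nonempty) (hSu : ¬ Bornology.IsBounded (conSet g h)) :
    ∀ t : ℝ, 0 < t → ({x | x ∈ conSet g h ∧ ‖x‖ = t} : Set (EuclideanSpace ℝ (Fin n))).Nonempty →
      (∃ x, x ∈ tangencySet f g h ∧ ‖x‖ = t ∧
        ∀ y ∈ conSet g h, ‖y‖ = t → f x ≤ f y) ∧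
      sInf (f '' {x | x ∈ conSet g h ∧ ‖x‖ = t}) =
        sInf (f '' {x | x ∈ tangencySet f g h ∧ ‖x‖ = t}) := by
  intro t _ hne
  have hclosed : IsClosed {x | x ∈ conSet g h ∧ ‖x‖ = t} := by
    simp only [conSet, Set.ofPred_and, Set.ofPred_forall]
    exact ((isClosed_iInter fun i => isClosed_eq (hg i).contDiff.continuous continuous_const).inter
      (isClosed_iInter fun j => isClosed_le continuous_const (hh j).contDiff.continuous)).inter
      (isClosed_eq continuous_norm continuous_const)
  have hcompact : IsCompact {x | x ∈ conSet g h ∧ ‖x‖ = t} :=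
    (isCompact_sphere 0 t).of_isClosed_subset hclosed fun x hx => by simpa using hx.2
  obtain ⟨x, ⟨hxS, rfl⟩, hmin⟩ := hcompact.exists_isMinOn hne hf.contDiff.continuous.continuousOn
  have hxmin : ∀ y ∈ conSet g h, ‖y‖ = ‖x‖ → f x ≤ f y := fun y hy hyx => hmin ⟨hy, hyx⟩
  have hxΓ := mem_tangencySet_of_forall_le hf.contDiff (fun i => (hg i).contDiff)
    (fun j => (hh j).contDiff) hxS hxmin
  refine ⟨⟨x, hxΓ, rfl, hxmin⟩, ?_⟩
  have hleast : IsLeast (f '' {y | y ∈ conSet g h ∧ ‖y‖ = ‖x‖}) (f x) :=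
    ⟨⟨x, ⟨hxS, rfl⟩, rfl⟩, by rintro _ ⟨y, hy, rfl⟩; exact hxmin y hy.1 hy.2⟩
  have hleastΓ : IsLeast (f '' {y | y ∈ tangencySet f g h ∧ ‖y‖ = ‖x‖}) (f x) :=
    ⟨⟨x, ⟨hxΓ, rfl⟩, rfl⟩, by rintro _ ⟨y, hy, rfl⟩; exact hxmin y hy.1.1 hy.2⟩
  rw [hleast.csInf_eq, hleastΓ.csInf_eq]
end
end

section
/- The function f is bounded from below on S if and only if f is bounded from below on the tangency variety Γ(f,S); likewise, f is bounded from above on S if and only if f is bounded from above on Γ(f,S). -/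
open Filter

noncomputable section

theorem IsPolyFun.hasStrictFDerivAt {n : ℕ} {f : EuclideanSpace ℝ (Fin n) → ℝ}
    (hf : IsPolyFun f) (x : EuclideanSpace ℝ (Fin n)) :
    HasStrictFDerivAt f (InnerProductSpace.toDual ℝ _ (gradient f x)) x := by
  have h := hf.contDiff.contDiffAt.hasStrictFDerivAt (x := x) one_ne_zero
  simpa [gradient] using h

theorem isClosed_conSet {n l m : ℕ} {g : Fin l → EuclideanSpace ℝ (Fin n) → ℝ}
    {h : Fin m → EuclideanSpace ℝ (Fin n) → ℝ}
    (hg : ∀ i, IsPolyFun (g i)) (hh : ∀ j, IsPolyFun (h j)) : IsClosed (conSet g h) := by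
  simp only [conSet, Set.ofPred_and, Set.ofPred_forall]
  exact (isClosed_iInter fun i => isClosed_eq (hg i).contDiff.continuous continuous_const).inter
    (isClosed_iInter fun j => isClosed_le continuous_const (hh j).contDiff.continuous)

/-- A point of the constraint set at which `f` has an extremum relative to the centred sphere
through that point is a tangency point. -/
theorem mem_tangencySet_of_isExtrOn {n l m : ℕ} {f : EuclideanSpace ℝ (Fin n) → ℝ}
    {g : Fin l → EuclideanSpace ℝ (Fin n) → ℝ} {h : Fin m → EuclideanSpace ℝ (Fin n) → ℝ}
    (hf : IsPolyFun f) (hg : ∀ i, IsPolyFun (g i)) (hh : ∀ j, IsPolyFun (h j))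
    {y : EuclideanSpace ℝ (Fin n)} (hy : y ∈ conSet g h)
    (hext : IsExtrOn f (conSet g h ∩ {z | ‖z‖ = ‖y‖}) y) : y ∈ tangencySet f g h := by
  classical
  let F : Fin l ⊕ {j : Fin m // h j y = 0} ⊕ Unit → EuclideanSpace ℝ (Fin n) → ℝ :=
    Sum.elim g (Sum.elim (fun j => h j.1) fun _ z => ‖z‖ ^ 2)
  let G : Fin l ⊕ {j : Fin m // h j y = 0} ⊕ Unit → EuclideanSpace ℝ (Fin n) :=
    Sum.elim (fun i => gradient (g i) y)
      (Sum.elim (fun j => gradient (h j.1) y) fun _ => (2 : ℝ) • y)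
  have hF : ∀ i, HasStrictFDerivAt (F i) (InnerProductSpace.toDual ℝ _ (G i)) y := by
    rintro (i | j | _)
    · exact (hg i).hasStrictFDerivAt y
    · exact (hh j.1).hasStrictFDerivAt y
    · have hG : InnerProductSpace.toDual ℝ _ ((2 : ℝ) • y) = 2 • innerSL ℝ y := by
        ext w
        simp
      exact hG ▸ hasStrictFDerivAt_norm_sq y
  have hloc : IsLocalExtrOn f {z | ∀ i, F i z = F i y} y := by
    have hinact : ∀ᶠ z in nhds y, ∀ j, h j y ≠ 0 → 0 ≤ h j z := by
      refine Filter.eventually_all.2 fun j => ?_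
      by_cases hj : h j y = 0
      · simp [hj]
      · filter_upwards [(hh j).contDiff.continuous.continuousAt.eventually
          (lt_mem_nhds ((hy.2 j).lt_of_ne' hj))] with z hz _ using hz.le
    refine IsExtrFilter.filter_mono (l := Filter.principal _) hext ?_
    rw [Filter.le_principal_iff]
    filter_upwards [self_mem_nhdsWithin, nhdsWithin_le_nhds hinact] with z hz hz'
    refine ⟨⟨fun i => (hz (.inl i)).trans (hy.1 i), fun j => ?_⟩, ?_⟩
    · by_cases hj : h j y = 0
      · exact ((hz (.inr (.inl ⟨j, hj⟩))).trans hj).ge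
      · exact hz' j hj
    · have h2 : ‖z‖ ^ 2 = ‖y‖ ^ 2 := hz (.inr (.inr ()))
      exact (sq_eq_sq₀ (norm_nonneg _) (norm_nonneg _)).1 h2
  obtain ⟨Λ, κ, hne, hsum⟩ := hloc.exists_multipliers_of_hasStrictFDerivAt hF
    (hf.hasStrictFDerivAt y)
  have hsum' : ∑ i, Λ i • G i + κ • gradient f y = 0 := by
    apply (InnerProductSpace.toDual ℝ (EuclideanSpace ℝ (Fin n))).injective
    simpa using hsum
  simp only [Fintype.sum_sum_type, G, Sum.elim_inl, Sum.elim_inr, Finset.univ_unique,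
    Finset.sum_singleton] at hsum'
  let ν : Fin m → ℝ := fun j => if hj : h j y = 0 then -Λ (.inr (.inl ⟨j, hj⟩)) else 0
  have hν : ∑ j, ν j • gradient (h j) y =
      -∑ j : {j : Fin m // h j y = 0}, Λ (.inr (.inl j)) • gradient (h j.1) y := by
    rw [← Finset.sum_neg_distrib, ← Finset.sum_filter_of_ne (p := fun j => h j y = 0),
      ← Finset.sum_subtype_eq_sum_filter]
    · refine Finset.sum_congr (by ext; simp) fun j _ => ?_
      simp [ν, j.2]
    · intro j _ hj
      by_contra hj'
      simp [ν, hj'] at hj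
  refine ⟨hy, κ, fun i => -Λ (.inl i), ν, -2 * Λ (.inr (.inr ())), fun h0 => hne ?_, ?_, ?_⟩
  · simp only [Prod.mk_eq_zero] at h0
    obtain ⟨hκ, hl, hn, hμ⟩ := h0
    refine Prod.ext (funext ?_) hκ
    rintro (i | j | _)
    · simpa using congrFun hl i
    · simpa [ν, j.2] using congrFun hn j
    · simpa using hμ
  · rw [hν, ← hsum']
    simp only [neg_smul, Finset.sum_neg_distrib, PUnit.default_eq_unit]
    module
  · intro j
    by_cases hj : h j y = 0 <;> simp [ν, hj]

theorem bounded_iff_bounded_on_tangency {n l m : ℕ} (f : EuclideanSpace ℝ (Fin n) → ℝ)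
    (g : Fin l → EuclideanSpace ℝ (Fin n) → ℝ) (h : Fin m → EuclideanSpace ℝ (Fin n) → ℝ)
    (hf : IsPolyFun f) (hg : ∀ i, IsPolyFun (g i)) (hh : ∀ j, IsPolyFun (h j))
    (hS : (conSet g h).Nonempty) (hSu : ¬ Bornology.IsBounded (conSet g h)) :
    (BddBelow (f '' conSet g h) ↔ BddBelow (f '' tangencySet f g h)) ∧
    (BddAbove (f '' conSet g h) ↔ BddAbove (f '' tangencySet f g h)) := by
  have hcpt (x : EuclideanSpace ℝ (Fin n)) : IsCompact (conSet g h ∩ {z | ‖z‖ = ‖x‖}) := by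
    have hset : {z : EuclideanSpace ℝ (Fin n) | ‖z‖ = ‖x‖} = Metric.sphere 0 ‖x‖ := by
      ext; simp
    rw [hset]
    exact (isCompact_sphere _ _).inter_left (isClosed_conSet hg hh)
  have hcont (s : Set (EuclideanSpace ℝ (Fin n))) : ContinuousOn f s :=
    hf.contDiff.continuous.continuousOn
  have hsub : tangencySet f g h ⊆ conSet g h := fun _ hx => hx.1
  refine ⟨⟨fun hb => hb.mono (Set.image_mono hsub), ?_⟩,
    ⟨fun hb => hb.mono (Set.image_mono hsub), ?_⟩⟩
  · rintro ⟨M, hM⟩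
    refine ⟨M, Set.forall_mem_image.2 fun x hx => ?_⟩
    obtain ⟨y, hy, hmin⟩ := (hcpt x).exists_isMinOn ⟨x, hx, rfl⟩ (hcont _)
    have hyx : ‖y‖ = ‖x‖ := hy.2
    exact (hM (Set.mem_image_of_mem f (mem_tangencySet_of_isExtrOn hf hg hh hy.1
      (.inl (by rwa [hyx]))))).trans (hmin ⟨hx, rfl⟩)
  · rintro ⟨M, hM⟩
    refine ⟨M, Set.forall_mem_image.2 fun x hx => ?_⟩
    obtain ⟨y, hy, hmax⟩ := (hcpt x).exists_isMaxOn ⟨x, hx, rfl⟩ (hcont _)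
    have hyx : ‖y‖ = ‖x‖ := hy.2
    exact (hmax ⟨hx, rfl⟩).trans (hM (Set.mem_image_of_mem f
      (mem_tangencySet_of_isExtrOn hf hg hh hy.1 (.inr (by rwa [hyx])))))
end
end
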